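/- Let U ⊆ ℝⁿ, let f : ℝⁿ → ℝⁿ be differentiable at every point of U, and let ε, C > 0 with ε·C < 1. Assume ‖Df_x − Id‖ ≤ ε for every x ∈ U, and assume that for any two points x₀, x₁ ∈ U there is a continuously differentiable curve γ : [0,1] → ℝⁿ with image contained in U, γ(0) = x₀, γ(1) = x₁, and ∫₀¹ ‖γ'(t)‖ dt ≤ C·‖x₀ − x₁‖. Then f restricted to U is injective. -/

import Mathlib

open Set in
/-- Mean value inequality along a curve: if `‖Dg‖ ≤ ε` along a `C¹` curve `γ` on `[0, 1]`, then `g`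
varies between the endpoints of `γ` by at most `ε` times the length of `γ`. -/
theorem norm_image_sub_le_mul_integral_norm_derivWithin
    {E F : Type*} [NormedAddCommGroup E] [NormedSpace ℝ E]
    [NormedAddCommGroup F] [NormedSpace ℝ F] {g : E → F} {g' : E → E →L[ℝ] F} {γ : ℝ → E} {ε : ℝ}
    (hγ : ContDiffOn ℝ 1 γ (Icc 0 1))
    (hg : ∀ t ∈ Icc (0 : ℝ) 1, HasFDerivAt g (g' (γ t)) (γ t))
    (hbound : ∀ t ∈ Icc (0 : ℝ) 1, ‖g' (γ t)‖ ≤ ε) :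
    ‖g (γ 1) - g (γ 0)‖ ≤ ε * ∫ t in (0 : ℝ)..1, ‖derivWithin γ (Icc 0 1) t‖ := by
  set speed : ℝ → ℝ := IccExtend zero_le_one
    ((Icc (0 : ℝ) 1).domRestrict fun t => ‖derivWithin γ (Icc 0 1) t‖) with hspeed
  have speed_eq : ∀ t ∈ Icc (0 : ℝ) 1, speed t = ‖derivWithin γ (Icc 0 1) t‖ := fun t ht => by
    rw [hspeed, IccExtend_of_mem _ _ ht]
    rfl
  have speed_cont : Continuous speed :=
    (hγ.continuousOn_derivWithin (uniqueDiffOn_Icc zero_lt_one) le_rfl).norm.domRestrict.Icc_extend'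
  have hcomp : ∀ t ∈ Icc (0 : ℝ) 1, HasDerivWithinAt (fun s => g (γ s) - g (γ 0))
      (g' (γ t) (derivWithin γ (Icc 0 1) t)) (Icc 0 1) t := fun t ht =>
    ((hg t ht).comp_hasDerivWithinAt t
      (hγ.differentiableOn one_ne_zero t ht).hasDerivWithinAt).sub_const _
  have key := image_norm_le_of_norm_deriv_right_le_deriv_boundary
    (B := fun s => ε * ∫ t in (0 : ℝ)..s, speed t) (B' := fun s => ε * speed s)
    (fun t ht => (hcomp t ht).continuousWithinAt)
    (fun t ht => (hcomp t (Ico_subset_Icc_self ht)).mono_of_mem_nhdsWithin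
      (Icc_mem_nhdsGE_of_mem ht))
    (by simp)
    (fun t => (speed_cont.integral_hasStrictDerivAt 0 t).hasDerivAt.const_mul ε)
    (fun t ht => by
      rw [speed_eq t (Ico_subset_Icc_self ht)]
      exact (g' (γ t)).le_of_opNorm_le (hbound t (Ico_subset_Icc_self ht)) _)
    (right_mem_Icc.2 zero_le_one)
  rwa [intervalIntegral.integral_congr (g := fun t => ‖derivWithin γ (Icc 0 1) t‖)
    (by rw [uIcc_of_le zero_le_one]; exact speed_eq)] at key


/-- Let `U ⊆ ℝⁿ`, `f : ℝⁿ → ℝⁿ` differentiable at every point of `U`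
with `‖Df_x − Id‖ ≤ ε` on `U`, and suppose `ε·C < 1` and any two points `x₀, x₁ ∈ U` can
be joined by a continuously differentiable curve `γ : [0,1] → ℝⁿ` inside `U` of length at
most `C·‖x₀ − x₁‖`.  Then `f` restricted to `U` is injective. -/
theorem injective_of_derivative_close_to_id {n : ℕ}
    (U : Set (EuclideanSpace ℝ (Fin n)))
    (f : EuclideanSpace ℝ (Fin n) → EuclideanSpace ℝ (Fin n))
    (f' : EuclideanSpace ℝ (Fin n) →
      (EuclideanSpace ℝ (Fin n) →L[ℝ] EuclideanSpace ℝ (Fin n)))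
    (hf : ∀ x ∈ U, HasFDerivAt f (f' x) x)
    (ε C : ℝ) (hε : 0 < ε) (hC : 0 < C) (hεC : ε * C < 1)
    (hder : ∀ x ∈ U, ‖f' x - ContinuousLinearMap.id ℝ (EuclideanSpace ℝ (Fin n))‖ ≤ ε)
    (hcurve : ∀ x₀ ∈ U, ∀ x₁ ∈ U, ∃ γ : ℝ → EuclideanSpace ℝ (Fin n),
      ContDiffOn ℝ 1 γ (Set.Icc 0 1) ∧
      (∀ t ∈ Set.Icc (0:ℝ) 1, γ t ∈ U) ∧
      γ 0 = x₀ ∧ γ 1 = x₁ ∧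
      (∫ t in (0:ℝ)..1, ‖derivWithin γ (Set.Icc 0 1) t‖) ≤ C * ‖x₀ - x₁‖) :
    Set.InjOn f U := by
  intro x₀ hx₀ x₁ hx₁ hfx
  obtain ⟨γ, hγ, hγU, rfl, rfl, hlen⟩ := hcurve x₀ hx₀ x₁ hx₁
  have hmv := norm_image_sub_le_mul_integral_norm_derivWithin
    (g := fun x => f x - x) (g' := fun x => f' x - ContinuousLinearMap.id ℝ _) hγ
    (fun t ht => (hf _ (hγU t ht)).sub (hasFDerivAt_id _)) (fun t ht => hder _ (hγU t ht))
  rw [hfx, sub_sub_sub_cancel_left] at hmv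
  have hle := hmv.trans (mul_le_mul_of_nonneg_left hlen hε.le)
  rw [← mul_assoc] at hle
  rw [← sub_eq_zero, ← norm_eq_zero]
  nlinarith [norm_nonneg (γ 0 - γ 1)]
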